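/- Under the protocol, for all distinct nodes i, j and all t ≥ 0, the estimate satisfies |x̂_{i,j,in}(t)| ≤ ‖x(0)‖_∞, where ‖x(0)‖_∞ = max_k |x_k(0)|. -/

import Mathlib

open scoped Classical

noncomputable section

/-- The rounding function `R` sending `x` to `1`, `0`, `-1` according to `x > 1`,
`-1 ≤ x ≤ 1`, `x < -1`. -/
def Rq (y : ℝ) : ℝ := if y > 1 then 1 else if y < -1 then -1 else 0

/-- The data and evolution equations of the ternary-message average-consensus protocol
on `n` nodes.  `E t i j` means the edge `(i,j)` is present in the graph `G(t)`
(for `t ≥ 1`); `x t i` is the value of node `i` at time `t`; `xin t i j` is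
`x̂_{i,j,in}(t)`, `xout t i j` is `x̂_{i,j,out}(t)` and `q t i j` is `q_{i→j}(t)`. -/
structure Protocol (n : ℕ) where
  α : ℝ
  β : ℝ
  hα : 0 < α
  hαβ : α < β
  hβ : β < 1
  E : ℕ → Fin n → Fin n → Prop
  Esymm : ∀ t i j, E t i j → E t j i
  Eirrefl : ∀ t i, ¬ E t i i
  D : Fin n → Fin n → ℕ → ℝ
  Dsymm : ∀ i j t, D i j t = D j i t
  Dbound : ∀ t i j, E t i j →
    ((max (Set.ncard {k | E t i k}) (Set.ncard {k | E t j k}) : ℕ) : ℝ) ≤ D i j t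
  x : ℕ → Fin n → ℝ
  xin : ℕ → Fin n → Fin n → ℝ
  xout : ℕ → Fin n → Fin n → ℝ
  q : ℕ → Fin n → Fin n → ℝ
  hxin0 : ∀ i j, xin 0 i j = 0
  hxout0 : ∀ i j, xout 0 i j = 0
  hq : ∀ t, 1 ≤ t → ∀ i j, E t i j →
    q t i j = Rq ((t : ℝ) ^ α * (x (t - 1) i - xout (t - 1) i j))
  hxoutE : ∀ t, 1 ≤ t → ∀ i j, E t i j →
    xout t i j = xout (t - 1) i j + q t i j / (t : ℝ) ^ α
  hxinE : ∀ t, 1 ≤ t → ∀ i j, E t i j →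
    xin t i j = xin (t - 1) i j + q t j i / (t : ℝ) ^ α
  hxoutN : ∀ t, 1 ≤ t → ∀ i j, ¬ E t i j → xout t i j = xout (t - 1) i j
  hxinN : ∀ t, 1 ≤ t → ∀ i j, ¬ E t i j → xin t i j = xin (t - 1) i j
  hx : ∀ t, 1 ≤ t → ∀ i, x t i = x (t - 1) i + (1 / (t : ℝ) ^ β) *
    ∑ j ∈ Finset.univ.filter (fun j => E t i j ∧
        4 / (t : ℝ) ^ α < |xin t i j - xout t i j| ∧ q t j i = 0 ∧ q t i j = 0),
      (xin t i j - xout t i j) / (4 * D i j t)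

namespace Protocol

variable {n : ℕ} (P : Protocol n)

/-- The set `S(i,t)` of neighbors that node `i` includes in its update at time `t`. -/
def S (t : ℕ) (i : Fin n) : Finset (Fin n) :=
  Finset.univ.filter (fun j => P.E t i j ∧
    4 / (t : ℝ) ^ P.α < |P.xin t i j - P.xout t i j| ∧ P.q t j i = 0 ∧ P.q t i j = 0)

/-- The graph sequence of the protocol is `B`-core-connected with core edge
relation `Einf`: every core edge appears at some time, the graph of core edges is
connected, and every core edge appears in every time window `[kB+1, (k+1)B]`. -/
def CoreConnected (B : ℕ) (Einf : Fin n → Fin n → Prop) : Prop :=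
  (∀ i j, Einf i j → ∃ t, 1 ≤ t ∧ P.E t i j) ∧
  (SimpleGraph.fromRel Einf).Connected ∧
  ∀ k : ℕ, ∀ i j, Einf i j → ∃ t, k * B + 1 ≤ t ∧ t ≤ (k + 1) * B ∧ P.E t i j

end Protocol

/-- `M(x)`: the largest coordinate. -/
def maxV {n : ℕ} (y : Fin n → ℝ) : ℝ := ⨆ i, y i

/-- `m(x)`: the smallest coordinate. -/
def minV {n : ℕ} (y : Fin n → ℝ) : ℝ := ⨅ i, y i

/-- `W(x) = M(x) - m(x)`. -/
def Wsp {n : ℕ} (y : Fin n → ℝ) : ℝ := maxV y - minV y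

/-- The sup norm `‖x‖_∞ = max_i |x_i|`. -/
def normInf {n : ℕ} (y : Fin n → ℝ) : ℝ := ⨆ i, |y i|

/-- `V2(x) = sqrt(Σ_i (x_i - (1/n) Σ_j x_j)²)`. -/
def V2 {n : ℕ} (y : Fin n → ℝ) : ℝ :=
  Real.sqrt (∑ i, (y i - (∑ j, y j) / n) ^ 2)

theorem Rq_eq_zero {y : ℝ} (h : Rq y = 0) : |y| ≤ 1 := by
  unfold Rq at h
  split_ifs at h with h₁ h₂
  · norm_num at h
  · norm_num at h
  · exact abs_le.2 ⟨not_lt.1 h₂, not_lt.1 h₁⟩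

/-- A quantized step of size `1 / c` towards `x` stays in any symmetric interval containing
both `x` and the starting point. -/
theorem abs_add_Rq_div_le {c x y M : ℝ} (hc : 0 < c) (hx : |x| ≤ M) (hy : |y| ≤ M) :
    |y + Rq (c * (x - y)) / c| ≤ M := by
  rw [abs_le] at hx hy ⊢
  have hinv : 0 < 1 / c := by positivity
  unfold Rq
  split_ifs with h₁ h₂
  · have h : 1 / c < x - y := (div_lt_iff₀' hc).2 h₁
    constructor <;> linarith
  · have h : x - y < -1 / c := (lt_div_iff₀' hc).2 h₂
    rw [neg_div] at h ⊢
    constructor <;> linarith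
  · simpa using hy

theorem sum_div_four_mul_le {ι : Type*} (s : Finset ι) (a D : ι → ℝ) {c : ℝ} {d : ℕ}
    (hc : 0 ≤ c) (hs : s.card ≤ d) (ha : ∀ j ∈ s, a j ≤ 4 * c) (hD : ∀ j ∈ s, (d : ℝ) ≤ D j) :
    ∑ j ∈ s, a j / (4 * D j) ≤ c := by
  rcases s.eq_empty_or_nonempty with rfl | hne
  · simpa using hc
  have hd : (0 : ℝ) < d := by exact_mod_cast hne.card_pos.trans_le hs
  have hterm : ∀ j ∈ s, a j / (4 * D j) ≤ c / d := fun j hj => by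
    have hDj := hD j hj
    calc a j / (4 * D j) ≤ 4 * c / (4 * D j) := by
          have : 0 < D j := hd.trans_le hDj
          gcongr
          exact ha j hj
      _ = c / D j := mul_div_mul_left _ _ (by norm_num)
      _ ≤ c / d := by gcongr
  calc ∑ j ∈ s, a j / (4 * D j) ≤ s.card • (c / d) := Finset.sum_le_card_nsmul _ _ _ hterm
    _ = s.card * (c / d) := nsmul_eq_mul _ _
    _ ≤ d * (c / d) := by gcongr
    _ = c := mul_div_cancel₀ _ hd.ne'

namespace Protocol

variable {n : ℕ} (P : Protocol n)

theorem xin_eq_xout (t : ℕ) (i j : Fin n) : P.xin t i j = P.xout t j i := by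
  induction t with
  | zero => rw [P.hxin0, P.hxout0]
  | succ s ih =>
    have ht : 1 ≤ s + 1 := Nat.le_add_left 1 s
    by_cases h : P.E (s + 1) i j
    · rw [P.hxinE _ ht _ _ h, P.hxoutE _ ht _ _ (P.Esymm _ _ _ h), Nat.add_sub_cancel, ih]
    · rw [P.hxinN _ ht _ _ h, P.hxoutN _ ht _ _ fun h' => h (P.Esymm _ _ _ h'),
        Nat.add_sub_cancel, ih]

theorem abs_xout_succ_le {M : ℝ} {s : ℕ} (hx : ∀ k, |P.x s k| ≤ M)
    (hout : ∀ k l, |P.xout s k l| ≤ M) (i j : Fin n) : |P.xout (s + 1) i j| ≤ M := by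
  have ht : 1 ≤ s + 1 := Nat.le_add_left 1 s
  by_cases h : P.E (s + 1) i j
  · rw [P.hxoutE _ ht _ _ h, P.hq _ ht _ _ h, Nat.add_sub_cancel]
    exact abs_add_Rq_div_le (by positivity) (hx i) (hout i j)
  · rw [P.hxoutN _ ht _ _ h]
    exact hout i j

theorem card_S_le (t : ℕ) (i : Fin n) : (P.S t i).card ≤ Set.ncard {k | P.E t i k} := by
  rw [← Set.ncard_coe_finset]
  refine Set.ncard_le_ncard (fun k hk => ?_) (Set.toFinite _)
  exact (Finset.mem_filter.1 hk).2.1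

theorem ncard_le_D {t : ℕ} {i j : Fin n} (h : P.E t i j) :
    (Set.ncard {k | P.E t i k} : ℝ) ≤ P.D i j t :=
  le_trans (by exact_mod_cast le_max_left _ _) (P.Dbound t i j h)

theorem abs_sub_xout_le {s : ℕ} {i j : Fin n} (h : P.E (s + 1) i j) (hq : P.q (s + 1) i j = 0) :
    |P.x s i - P.xout (s + 1) i j| ≤ 1 / ((s + 1 : ℕ) : ℝ) ^ P.α := by
  have ht : 1 ≤ s + 1 := Nat.le_add_left 1 s
  have hpos : (0 : ℝ) < ((s + 1 : ℕ) : ℝ) ^ P.α := by positivity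
  have hR := hq
  rw [P.hq _ ht _ _ h] at hR
  have h₁ := Rq_eq_zero hR
  rw [abs_mul, abs_of_pos hpos] at h₁
  rw [P.hxoutE _ ht _ _ h, hq, zero_div, add_zero]
  exact (le_div_iff₀' hpos).2 h₁

theorem sub_mem_S_bounds {M : ℝ} {s : ℕ} {i j : Fin n} (hx : |P.x s i| ≤ M)
    (hin : |P.xin (s + 1) i j| ≤ M) (hj : j ∈ P.S (s + 1) i) :
    P.xin (s + 1) i j - P.xout (s + 1) i j ≤ 4 * (M - P.x s i) ∧
      -(P.xin (s + 1) i j - P.xout (s + 1) i j) ≤ 4 * (M + P.x s i) := by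
  obtain ⟨-, hE, hlt, -, hq⟩ := Finset.mem_filter.1 hj
  have h := abs_le.1 (P.abs_sub_xout_le hE hq)
  rw [abs_le] at hx hin
  have hpos : (0 : ℝ) < 1 / ((s + 1 : ℕ) : ℝ) ^ P.α := by positivity
  have h4 : 4 / ((s + 1 : ℕ) : ℝ) ^ P.α = 4 * (1 / ((s + 1 : ℕ) : ℝ) ^ P.α) := by ring
  rw [h4, lt_abs] at hlt
  constructor <;> rcases hlt with hlt | hlt <;> linarith

theorem abs_x_succ_le {M : ℝ} {s : ℕ} {i : Fin n} (hx : |P.x s i| ≤ M)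
    (hin : ∀ j, |P.xin (s + 1) i j| ≤ M) : |P.x (s + 1) i| ≤ M := by
  have hstep := P.hx (s + 1) (Nat.le_add_left 1 s) i
  rw [Nat.add_sub_cancel] at hstep
  change _ = _ + _ * ∑ j ∈ P.S (s + 1) i, _ at hstep
  have hD : ∀ j ∈ P.S (s + 1) i, (Set.ncard {k | P.E (s + 1) i k} : ℝ) ≤ P.D i j (s + 1) :=
    fun j hj => P.ncard_le_D (Finset.mem_filter.1 hj).2.1
  have hM := abs_le.1 hx
  have hup := sum_div_four_mul_le (P.S (s + 1) i)
    (fun j => P.xin (s + 1) i j - P.xout (s + 1) i j) (fun j => P.D i j (s + 1))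
    (c := M - P.x s i) (by linarith) (P.card_S_le _ _)
    (fun j hj => (P.sub_mem_S_bounds hx (hin j) hj).1) hD
  have hlow := sum_div_four_mul_le (P.S (s + 1) i)
    (fun j => -(P.xin (s + 1) i j - P.xout (s + 1) i j)) (fun j => P.D i j (s + 1))
    (c := M + P.x s i) (by linarith) (P.card_S_le _ _)
    (fun j hj => (P.sub_mem_S_bounds hx (hin j) hj).2) hD
  simp only [neg_div, Finset.sum_neg_distrib] at hlow
  have hβ : 0 ≤ P.β := (P.hα.trans P.hαβ).le
  have hw₀ : 0 ≤ 1 / ((s + 1 : ℕ) : ℝ) ^ P.β := by positivity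
  have hw₁ : 1 / ((s + 1 : ℕ) : ℝ) ^ P.β ≤ 1 := by
    rw [div_le_one (by positivity)]
    exact Real.one_le_rpow (by exact_mod_cast Nat.le_add_left 1 s) hβ
  rw [hstep, abs_le]
  generalize 1 / ((s + 1 : ℕ) : ℝ) ^ P.β = w at hw₀ hw₁ ⊢
  constructor
  · nlinarith [mul_le_mul_of_nonneg_left hlow hw₀]
  · nlinarith [mul_le_mul_of_nonneg_left hup hw₀]

theorem abs_x_le_and_abs_xout_le {M : ℝ} (hM : 0 ≤ M) (h₀ : ∀ k, |P.x 0 k| ≤ M) (t : ℕ) :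
    (∀ k, |P.x t k| ≤ M) ∧ ∀ k l, |P.xout t k l| ≤ M := by
  induction t with
  | zero => exact ⟨h₀, fun k l => by rwa [P.hxout0, abs_zero]⟩
  | succ s ih =>
    have hout := P.abs_xout_succ_le ih.1 ih.2
    refine ⟨fun k => P.abs_x_succ_le (ih.1 k) fun j => ?_, hout⟩
    rw [P.xin_eq_xout]
    exact hout j k

end Protocol

/-- every estimate satisfies `|x̂_{i,j,in}(t)| ≤ ‖x(0)‖_∞`. -/
theorem stmt7_estimates_bounded {n : ℕ} (hn : 1 ≤ n) (P : Protocol n)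
    (i j : Fin n) (hij : i ≠ j) (t : ℕ) :
    |P.xin t i j| ≤ normInf (P.x 0) := by
  have h₀ : ∀ k, |P.x 0 k| ≤ normInf (P.x 0) := fun k =>
    le_ciSup (f := fun k => |P.x 0 k|) (Set.finite_range _).bddAbove k
  rw [P.xin_eq_xout]
  exact (P.abs_x_le_and_abs_xout_le ((abs_nonneg _).trans (h₀ i)) h₀ t).2 j i
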